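/- The connectivity constant of Hamiltonian cycles on the Sierpinski gasket is 12^(1/9): with v(SG(n)) = (3/2)(3^n + 1) the number of vertices of SG(n), the limit as n → ∞ of ln HC(n) / v(SG(n)) equals (1/9)·ln 12. -/

import Mathlib

open scoped Classical
open Filter Topology

noncomputable section

namespace SierpinskiGasket

/-- √3 -/
def sq3 : ℝ := Real.sqrt 3

/-- the origin, leftmost outmost vertex of every `SG n` -/
def o : ℝ × ℝ := (0, 0)

/-- `a m = (2^m, 0)`, the rightmost vertex of `SG m` (also a translation vector). -/
def a (m : ℕ) : ℝ × ℝ := ((2:ℝ) ^ m, 0)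

/-- `b m = (2^(m-1), 2^(m-1)·√3)`, the topmost vertex of `SG m`. -/
def b (m : ℕ) : ℝ × ℝ := ((2:ℝ) ^ m / 2, (2:ℝ) ^ m / 2 * sq3)

/-- `c m = (3·2^(m-1), 2^(m-1)·√3)`. -/
def c (m : ℕ) : ℝ × ℝ := (3 * (2:ℝ) ^ m / 2, (2:ℝ) ^ m / 2 * sq3)

/-- vertex set of `SG n` -/
def V : ℕ → Set (ℝ × ℝ)
  | 0 => {o, a 0, b 0}
  | n + 1 => V n ∪ ((· + a n) '' V n) ∪ ((· + b n) '' V n)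

/-- edge set of `SG n` -/
def E : ℕ → Set (Sym2 (ℝ × ℝ))
  | 0 => {s(o, a 0), s(o, b 0), s(a 0, b 0)}
  | n + 1 => E n ∪ (Sym2.map (· + a n) '' E n) ∪ (Sym2.map (· + b n) '' E n)

/-- `SG n` as a simple graph on `ℝ × ℝ` -/
def G (n : ℕ) : SimpleGraph (ℝ × ℝ) := SimpleGraph.fromEdgeSet (E n)

/-- a Hamiltonian path of `SG n`: a path visiting every vertex of `SG n` exactly once -/
def IsHamPath (n : ℕ) {u v : ℝ × ℝ} (p : (G n).Walk u v) : Prop :=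
  p.IsPath ∧ ∀ x, x ∈ p.support ↔ x ∈ V n

/-- a Hamiltonian cycle of `SG n` -/
def IsHamCycle (n : ℕ) {u : ℝ × ℝ} (p : (G n).Walk u u) : Prop :=
  p.IsCycle ∧ ∀ x, x ∈ p.support ↔ x ∈ V n

/-- `f n u v`: the number of Hamiltonian paths of `SG n` with end-vertex set `{u, v}`
(for `u ≠ v`, such unordered paths correspond bijectively to walks from `u` to `v`). -/
def f (n : ℕ) (u v : ℝ × ℝ) : ℕ := Nat.card {p : (G n).Walk u v // IsHamPath n p}

/-- `f1 n`: the number of Hamiltonian paths of `SG n` with end-vertex set `{o, a n}` -/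
def f1 (n : ℕ) : ℕ := f n o (a n)

/-- the number of Hamiltonian cycles of `SG n`, counted up to starting vertex and
orientation: every Hamiltonian cycle passes through `o` and has exactly two
representatives as a closed walk based at `o`. -/
def HC (n : ℕ) : ℕ := Nat.card {p : (G n).Walk o o // IsHamCycle n p} / 2

/-- the number of Hamiltonian paths of `SG n` having `o` as one of their end vertices -/
def H0 (n : ℕ) : ℕ := ∑ᶠ x ∈ {x : ℝ × ℝ | x ≠ o}, f n o x

/-- the total number of Hamiltonian paths of `SG n` (a path and its reversal
are the same unordered object, whence the division by `2`). -/
def H (n : ℕ) : ℕ := (∑ᶠ u : ℝ × ℝ, ∑ᶠ v : ℝ × ℝ, f n u v) / 2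

/-- the distribution ratio `F(n,x) = f(n,x)/f1(n)` -/
def F (n : ℕ) (x : ℝ × ℝ) : ℝ := (f n o x : ℝ) / (f1 n : ℝ)

/-- `SG n` with the vertex `b n` (and its incident edges) deleted -/
def Gd (n : ℕ) : SimpleGraph (ℝ × ℝ) := SimpleGraph.fromEdgeSet {e ∈ E n | b n ∉ e}

/-- Hamiltonian path of `SG n - b n` -/
def IsHamPathD (n : ℕ) {u v : ℝ × ℝ} (p : (Gd n).Walk u v) : Prop :=
  p.IsPath ∧ ∀ x, x ∈ p.support ↔ (x ∈ V n ∧ x ≠ b n)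

/-- `g2 n x`: the number of Hamiltonian paths of `SG n - b n` with end-vertex set `{o, x}` -/
def g2 (n : ℕ) (x : ℝ × ℝ) : ℕ := Nat.card {p : (Gd n).Walk o x // IsHamPathD n p}

/-- `g1 n`: the number of Hamiltonian paths of `SG n - b n` with end-vertex set `{o, a n}` -/
def g1 (n : ℕ) : ℕ := g2 n (a n)

/-- the distribution ratio `G₂(n,x) = g₂(n,x)/g₁(n)` -/
def G2 (n : ℕ) (x : ℝ × ℝ) : ℝ := (g2 n x : ℝ) / (g1 n : ℝ)

/-- mid-side vertex `a_{m,1} = (3·2^(m-1), 0)` -/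
def a1 (m : ℕ) : ℝ × ℝ := (3 * (2:ℝ) ^ m / 2, 0)

/-- mid-side vertex `b_{m,1} = (5·2^(m-2), 2^(m-2)·√3)` -/
def b1 (m : ℕ) : ℝ × ℝ := (5 * (2:ℝ) ^ m / 4, (2:ℝ) ^ m / 4 * sq3)

/-- mid-side vertex `c_{m,1} = (7·2^(m-2), 2^(m-2)·√3)` -/
def c1 (m : ℕ) : ℝ × ℝ := (7 * (2:ℝ) ^ m / 4, (2:ℝ) ^ m / 4 * sq3)

/-- mid-side vertex `a_{m,2} = (2^m, 2^(m-1)·√3)` -/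
def a2 (m : ℕ) : ℝ × ℝ := ((2:ℝ) ^ m, (2:ℝ) ^ m / 2 * sq3)

/-- mid-side vertex `b_{m,2} = (3·2^(m-2), 3·2^(m-2)·√3)` -/
def b2 (m : ℕ) : ℝ × ℝ := (3 * (2:ℝ) ^ m / 4, 3 * (2:ℝ) ^ m / 4 * sq3)

/-- mid-side vertex `c_{m,2} = (5·2^(m-2), 3·2^(m-2)·√3)` -/
def c2 (m : ℕ) : ℝ × ℝ := (5 * (2:ℝ) ^ m / 4, 3 * (2:ℝ) ^ m / 4 * sq3)

/-- exceptional vertex `a* = (2^(n-1), (2^(n-1)-1)·√3)` -/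
def astar (n : ℕ) : ℝ × ℝ := ((2:ℝ) ^ n / 2, ((2:ℝ) ^ n / 2 - 1) * sq3)

/-- exceptional vertex `b* = (2^(n-1) - 1/2, (2^n-1)·√3/2)` -/
def bstar (n : ℕ) : ℝ × ℝ := ((2:ℝ) ^ n / 2 - 1/2, ((2:ℝ) ^ n - 1) * sq3 / 2)

/-- exceptional vertex `c* = (2^(n-1) + 1/2, (2^n-1)·√3/2)` -/
def cstar (n : ℕ) : ℝ × ℝ := ((2:ℝ) ^ n / 2 + 1/2, ((2:ℝ) ^ n - 1) * sq3 / 2)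

/-- the Euclidean norm on `ℝ × ℝ` -/
def enorm (x : ℝ × ℝ) : ℝ := Real.sqrt (x.1 ^ 2 + x.2 ^ 2)

/-- the set `C n` of corner vertices of `SG n` -/
def C (n : ℕ) : Finset (ℝ × ℝ) :=
  ((Finset.range (n + 1)).image a) ∪ ((Finset.range (n + 1)).image b) ∪
    ((Finset.range n).image c)

/-- the mean `ℓ` displacement over the corner vertices -/
def xi' (n : ℕ) (ℓ : ℝ) : ℝ :=
  (∑ x ∈ C n, enorm x ^ ℓ * F n x) / (∑ x ∈ C n, F n x)

/-- `p(n,x)`: the probability that a Hamiltonian path with one end at `o`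
has its other end at `x` -/
def p (n : ℕ) (x : ℝ × ℝ) : ℝ := (f n o x : ℝ) / (H0 n : ℝ)

/-- the mean `ℓ` displacement of Hamiltonian paths on `SG n` with one end at `o` -/
def xi (n : ℕ) (ℓ : ℝ) : ℝ :=
  ∑ᶠ x ∈ {x : ℝ × ℝ | x ∈ V n ∧ x ≠ o}, enorm x ^ ℓ * p n x

/-- the partition function of Hamiltonian paths on `SG n` -/
def Z (n : ℕ) (β : ℝ) : ℝ := (H n : ℝ) * Real.exp (-(β * ((3 ^ (n + 1) + 1) / 2)))

section Gluing

variable {α : Type*}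

/-- lists `m` for which `x :: m ++ [y]` is a Hamiltonian path of `(V, R)`. -/
def Ham (V : Set α) (R : α → α → Prop) (x y : α) : Set (List α) :=
  {m | (x :: (m ++ [y])).IsChain R ∧ (x :: (m ++ [y])).Nodup ∧ ∀ v, v ∈ x :: (m ++ [y]) ↔ v ∈ V}

/-- lists `m` for which `x :: m ++ [x]` is a Hamiltonian cycle of `(V, R)`. -/
def HamCyc (V : Set α) (R : α → α → Prop) (x : α) : Set (List α) :=
  {m | (x :: (m ++ [x])).IsChain R ∧ (x :: m).Nodup ∧ ∀ v, v ∈ x :: m ↔ v ∈ V}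

/-- three graphs, on `V1`, `V2` and `V3`, any two of which share exactly one vertex: `p` lies in
`V1` and `V2`, `q` in `V1` and `V3`, and `r` in `V2` and `V3`. -/
structure Glue (V1 V2 V3 : Set α) (R1 R2 R3 : α → α → Prop) (p q r : α) : Prop where
  e1 : ∀ u v, R1 u v → u ∈ V1 ∧ v ∈ V1
  e2 : ∀ u v, R2 u v → u ∈ V2 ∧ v ∈ V2
  e3 : ∀ u v, R3 u v → u ∈ V3 ∧ v ∈ V3
  p1 : p ∈ V1
  p2 : p ∈ V2
  q1 : q ∈ V1
  q3 : q ∈ V3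
  r2 : r ∈ V2
  r3 : r ∈ V3
  hp : ∀ v, v ∈ V1 → v ∈ V2 → v = p
  hq : ∀ v, v ∈ V1 → v ∈ V3 → v = q
  hr : ∀ v, v ∈ V2 → v ∈ V3 → v = r
  pq : p ≠ q
  pr : p ≠ r
  qr : q ≠ r

/-- the list obtained from three lists by putting `u` and `w` in the gaps. -/
def join (u w : α) (t : List α × List α × List α) : List α := t.1 ++ u :: (t.2.1 ++ w :: t.2.2)

variable {V1 V2 V3 : Set α} {R1 R2 R3 : α → α → Prop} {p q r x y z : α}

theorem Glue.interior (g : Glue V1 V2 V3 R1 R2 R3 p q r) {u w : α} {m : List α}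
    (hc : (u :: (m ++ [w])).IsChain (fun u v => R1 u v ∨ R2 u v ∨ R3 u v))
    (hu : u ≠ p ∧ u ≠ q ∧ u ≠ r) (hm : ∀ v ∈ m, v ≠ p ∧ v ≠ q ∧ v ≠ r) :
    (u ∈ V1 → (u :: (m ++ [w])).IsChain R1) ∧ (u ∈ V2 → (u :: (m ++ [w])).IsChain R2) ∧
    (u ∈ V3 → (u :: (m ++ [w])).IsChain R3) := by
  obtain ⟨e1, e2, e3, p1, p2, q1, q3, r2, r3, hp, hq, hr, pq, pr, qr⟩ := g
  induction m generalizing u with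
  | nil =>
    simp only [List.nil_append, List.isChain_pair] at hc ⊢
    grind
  | cons a m ih =>
    simp only [List.cons_append, List.isChain_cons_cons] at hc ⊢
    have := ih hc.2 (hm a (by simp)) (fun v hv => hm v (by simp [hv]))
    grind

theorem Glue.segment (g : Glue V1 V2 V3 R1 R2 R3 p q r) {u w : α} {m : List α}
    (hc : (u :: (m ++ [w])).IsChain (fun u v => R1 u v ∨ R2 u v ∨ R3 u v))
    (hm : ∀ v ∈ m, v ≠ p ∧ v ≠ q ∧ v ≠ r) :
    (u :: (m ++ [w])).IsChain R1 ∨ (u :: (m ++ [w])).IsChain R2 ∨ (u :: (m ++ [w])).IsChain R3 := by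
  cases m with
  | nil => simpa using hc
  | cons a m =>
    simp only [List.cons_append, List.isChain_cons_cons] at hc ⊢
    have := g.interior hc.2 (hm a (by simp)) (fun v hv => hm v (by simp [hv]))
    obtain ⟨e1, e2, e3, p1, p2, q1, q3, r2, r3, hp, hq, hr, pq, pr, qr⟩ := g
    grind

theorem mem_of_chain {R : α → α → Prop} {V : Set α} (e : ∀ u v, R u v → u ∈ V ∧ v ∈ V)
    {u w : α} {m : List α} (hc : (u :: (m ++ [w])).IsChain R) : ∀ v ∈ u :: (m ++ [w]), v ∈ V := by
  induction m generalizing u with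
  | nil =>
    simp only [List.nil_append, List.isChain_pair] at hc
    have := e _ _ hc
    simpa
  | cons a m ih =>
    simp only [List.cons_append, List.isChain_cons_cons] at hc
    have := ih hc.2
    have := e _ _ hc.1
    grind

theorem Glue.segment' (g : Glue V1 V2 V3 R1 R2 R3 p q r) {u w : α} {m : List α}
    (hc : (u :: (m ++ [w])).IsChain (fun u v => R1 u v ∨ R2 u v ∨ R3 u v))
    (hm : ∀ v ∈ m, v ≠ p ∧ v ≠ q ∧ v ≠ r) :
    ((u :: (m ++ [w])).IsChain R1 ∧ ∀ v ∈ u :: (m ++ [w]), v ∈ V1) ∨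
    ((u :: (m ++ [w])).IsChain R2 ∧ ∀ v ∈ u :: (m ++ [w]), v ∈ V2) ∨
    ((u :: (m ++ [w])).IsChain R3 ∧ ∀ v ∈ u :: (m ++ [w]), v ∈ V3) := by
  rcases g.segment hc hm with h | h | h
  · exact .inl ⟨h, mem_of_chain g.e1 h⟩
  · exact .inr (.inl ⟨h, mem_of_chain g.e2 h⟩)
  · exact .inr (.inr ⟨h, mem_of_chain g.e3 h⟩)

theorem split3 {m : List α} (hm : m.Nodup) (hp : p ∈ m) (hq : q ∈ m) (hr : r ∈ m)
    (pq : p ≠ q) (pr : p ≠ r) (qr : q ≠ r) :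
    ∃ A B C D j1 j2 j3, m = A ++ j1 :: (B ++ j2 :: (C ++ j3 :: D)) ∧
     ((j1 = p ∧ j2 = q ∧ j3 = r) ∨ (j1 = p ∧ j2 = r ∧ j3 = q) ∨ (j1 = q ∧ j2 = p ∧ j3 = r) ∨
      (j1 = q ∧ j2 = r ∧ j3 = p) ∨ (j1 = r ∧ j2 = p ∧ j3 = q) ∨ (j1 = r ∧ j2 = q ∧ j3 = p)) := by
  have key : ∀ u v w : α, u ∈ m → v ∈ m → w ∈ m → u ≠ v → u ≠ w → v ≠ w →
      ∃ s t, m = s ++ u :: t ∧ (v ∈ s ∨ v ∈ t) ∧ (w ∈ s ∨ w ∈ t) := by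
    intro u v w hu hv hw _ _ _
    obtain ⟨s, t, rfl⟩ := List.append_of_mem hu
    exact ⟨s, t, rfl, by grind, by grind⟩
  have two : ∀ (t : List α) (u v : α), u ∈ t → v ∈ t → u ≠ v →
      ∃ A B C, t = A ++ u :: (B ++ v :: C) ∨ t = A ++ v :: (B ++ u :: C) := by
    intro t u v hu hv huv
    obtain ⟨s, t, rfl⟩ := List.append_of_mem hu
    have : v ∈ s ∨ v ∈ t := by grind
    rcases this with h | h
    · obtain ⟨s1, t1, rfl⟩ := List.append_of_mem h
      exact ⟨s1, t1, t, .inr (by simp)⟩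
    · obtain ⟨s1, t1, rfl⟩ := List.append_of_mem h
      exact ⟨s, s1, t1, .inl (by simp)⟩
  obtain ⟨s, t, rfl, h1 | h1, h2 | h2⟩ := key p q r hp hq hr pq pr qr
  · obtain ⟨A, B, C, rfl | rfl⟩ := two _ _ _ h1 h2 qr
    · exact ⟨A, B, C, t, q, r, p, by simp, by simp⟩
    · exact ⟨A, B, C, t, r, q, p, by simp, by simp⟩
  · obtain ⟨A, B, rfl⟩ := List.append_of_mem h1
    obtain ⟨C, D, rfl⟩ := List.append_of_mem h2
    exact ⟨A, B, C, D, q, p, r, by simp, by simp⟩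
  · obtain ⟨A, B, rfl⟩ := List.append_of_mem h2
    obtain ⟨C, D, rfl⟩ := List.append_of_mem h1
    exact ⟨A, B, C, D, r, p, q, by simp, by simp⟩
  · obtain ⟨A, B, C, rfl | rfl⟩ := two _ _ _ h1 h2 qr
    · exact ⟨s, A, B, C, p, q, r, by simp, by simp⟩
    · exact ⟨s, A, B, C, p, r, q, by simp, by simp⟩

theorem chain2 {R : α → α → Prop} {u y j : α} {A B : List α} :
    (u :: (A ++ j :: B ++ [y])).IsChain R ↔
      (u :: (A ++ [j])).IsChain R ∧ (j :: (B ++ [y])).IsChain R := by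
  rw [List.append_assoc, List.cons_append, List.isChain_cons_split]

theorem chain3 {R : α → α → Prop} {u y j k : α} {A B C : List α} :
    (u :: (A ++ j :: (B ++ k :: C) ++ [y])).IsChain R ↔
      (u :: (A ++ [j])).IsChain R ∧ (j :: (B ++ [k])).IsChain R ∧ (k :: (C ++ [y])).IsChain R := by
  rw [chain2, chain2]

theorem chain4 {R : α → α → Prop} {u y j k l : α} {A B C D : List α} :
    (u :: (A ++ j :: (B ++ k :: (C ++ l :: D)) ++ [y])).IsChain R ↔
      (u :: (A ++ [j])).IsChain R ∧ (j :: (B ++ [k])).IsChain R ∧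
      (k :: (C ++ [l])).IsChain R ∧ (l :: (D ++ [y])).IsChain R := by
  rw [chain2, chain3]

theorem nodup_split {u y j : α} {A B : List α} (h : (u :: (A ++ j :: B ++ [y])).Nodup) :
    (u :: (A ++ [j])).Nodup ∧ (j :: (B ++ [y])).Nodup ∧ ∀ v ∈ u :: A, v ∉ j :: (B ++ [y]) := by
  have e : u :: (A ++ j :: B ++ [y]) = (u :: A) ++ (j :: (B ++ [y])) := by simp
  have e' : u :: (A ++ [j]) = (u :: A) ++ [j] := rfl
  rw [e, List.nodup_append] at h
  refine ⟨?_, h.2.1, fun v hv hv' => h.2.2 v hv v hv' rfl⟩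
  rw [e', List.nodup_append]
  refine ⟨h.1, by simp, fun v hv w hw => h.2.2 v hv w ?_⟩
  simp at hw ⊢
  tauto

theorem nodup_cyc_split {u j : α} {A B : List α} (h : (u :: (A ++ j :: B)).Nodup) :
    (u :: (A ++ [j])).Nodup ∧ (j :: (B ++ [u])).Nodup := by
  have e : u :: (A ++ j :: B) = (u :: A) ++ (j :: B) := by simp
  have e' : u :: (A ++ [j]) = (u :: A) ++ [j] := rfl
  have e2 : j :: (B ++ [u]) = (j :: B) ++ [u] := rfl
  rw [e, List.nodup_append] at h
  rw [e', e2, List.nodup_append, List.nodup_append]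
  refine ⟨⟨h.1, by simp, fun v hv w hw => h.2.2 v hv w ?_⟩, h.2.1, by simp, fun v hv w hw => ?_⟩
  · simp at hw ⊢; tauto
  · simp only [List.mem_singleton] at hw
    subst hw
    exact (h.2.2 w (by simp) v hv).symm

theorem nodup_glue2 {u y j : α} {A B : List α} (n1 : (u :: (A ++ [j])).Nodup)
    (n2 : (j :: (B ++ [y])).Nodup)
    (h : ∀ v ∈ u :: (A ++ [j]), v ∈ j :: (B ++ [y]) → v = j) :
    (u :: (A ++ j :: B ++ [y])).Nodup := by
  have e : u :: (A ++ j :: B ++ [y]) = (u :: A) ++ (j :: (B ++ [y])) := by simp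
  have n1' : (u :: A).Nodup ∧ j ∉ u :: A := by
    have : u :: (A ++ [j]) = (u :: A) ++ [j] := rfl
    rw [this, List.nodup_append] at n1
    exact ⟨n1.1, fun hj => n1.2.2 j hj j (by simp) rfl⟩
  rw [e, List.nodup_append]
  refine ⟨n1'.1, n2, ?_⟩
  rintro v hv w hw rfl
  have := h v (by simp at hv ⊢; tauto) hw
  exact n1'.2 (this ▸ hv)

theorem nodup_glue3 {u y j k : α} {A B C : List α} (n1 : (u :: (A ++ [j])).Nodup)
    (n2 : (j :: (B ++ [k])).Nodup) (n3 : (k :: (C ++ [y])).Nodup)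
    (h12 : ∀ v ∈ u :: (A ++ [j]), v ∈ j :: (B ++ [k]) → v = j)
    (h23 : ∀ v ∈ j :: (B ++ [k]), v ∈ k :: (C ++ [y]) → v = k)
    (h13 : ∀ v ∈ u :: (A ++ [j]), v ∉ k :: (C ++ [y])) :
    (u :: (A ++ j :: (B ++ k :: C) ++ [y])).Nodup := by
  refine nodup_glue2 n1 (nodup_glue2 n2 n3 h23) fun v hv hv2 => ?_
  have := h12 v hv; have := h13 v hv
  simp at *
  tauto

theorem nodup_cyc3 {u j k : α} {A B C : List α} (n1 : (u :: (A ++ [j])).Nodup)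
    (n2 : (j :: (B ++ [k])).Nodup) (n3 : (k :: (C ++ [u])).Nodup)
    (h12 : ∀ v ∈ u :: (A ++ [j]), v ∈ j :: (B ++ [k]) → v = j)
    (h23 : ∀ v ∈ j :: (B ++ [k]), v ∈ k :: (C ++ [u]) → v = k)
    (h13 : ∀ v ∈ u :: (A ++ [j]), v ∈ k :: (C ++ [u]) → v = u) :
    (u :: (A ++ j :: (B ++ k :: C))).Nodup := by
  have h := nodup_glue2 n2 n3 h23
  have h' : (j :: (B ++ k :: C)).Nodup ∧ u ∉ j :: (B ++ k :: C) := by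
    have e : j :: (B ++ k :: C ++ [u]) = (j :: (B ++ k :: C)) ++ [u] := rfl
    rw [e, List.nodup_append] at h
    exact ⟨h.1, fun hj => h.2.2 u hj u (by simp) rfl⟩
  have n1' : (u :: A).Nodup ∧ j ∉ u :: A := by
    have : u :: (A ++ [j]) = (u :: A) ++ [j] := rfl
    rw [this, List.nodup_append] at n1
    exact ⟨n1.1, fun hj => n1.2.2 j hj j (by simp) rfl⟩
  rw [← List.cons_append, List.nodup_append]
  refine ⟨n1'.1, h'.1, ?_⟩
  rintro v hv w hw rfl
  have hv' : v ∈ u :: (A ++ [j]) := by simp at hv ⊢; tauto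
  have a1 := h12 v hv'
  have a2 := h13 v hv'
  have : v = j ∨ v = u := by simp at hw a1 a2 ⊢; tauto
  rcases this with rfl | rfl
  · exact n1'.2 hv
  · exact h'.2 hw

set_option maxHeartbeats 2000000 in
theorem Glue.ham_eq (g : Glue V1 V2 V3 R1 R2 R3 p q r) {T : Set α} (hT : ∀ v ∈ T, v ∈ V3)
    (hqT : q ∈ T) (hrT : r ∈ T) (hx : x ∈ V1) (xp : x ≠ p) (xq : x ≠ q)
    (hy : y ∈ V2) (yp : y ≠ p) (yr : y ≠ r) :
    Ham {v | v ∈ V1 ∨ v ∈ V2 ∨ v ∈ T} (fun u v => R1 u v ∨ R2 u v ∨ R3 u v) x y =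
      join q r '' (Ham V1 R1 x q ×ˢ Ham T R3 q r ×ˢ Ham (V2 \ {p}) R2 r y) ∪
      (join q r '' (Ham (V1 \ {p}) R1 x q ×ˢ Ham T R3 q r ×ˢ Ham V2 R2 r y) ∪
      {m | m ∈ (fun t : List α × List α => t.1 ++ p :: t.2) '' (Ham V1 R1 x p ×ˢ Ham V2 R2 p y) ∧
        T = {q, r}}) := by
  have seg := @Glue.segment' _ _ _ _ _ _ _ _ _ _ g
  obtain ⟨e1, e2, e3, p1, p2, q1, q3, r2, r3, hp, hq, hr, pq, pr, qr⟩ := g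
  have xr : x ≠ r := by grind
  have yq : y ≠ q := by grind
  have xy : x ≠ y := by grind
  have hx2 : x ∉ V2 := fun h => xp (hp _ hx h)
  have hx3 : x ∉ V3 := fun h => xq (hq _ hx h)
  have hy1 : y ∉ V1 := fun h => yp (hp _ h hy)
  have hy3 : y ∉ V3 := fun h => yr (hr _ hy h)
  have p3 : p ∉ V3 := fun h => pq (hq _ p1 h)
  have hq2 : q ∉ V2 := fun h => pq.symm (hp _ q1 h)
  have hr1 : r ∉ V1 := fun h => pr.symm (hp _ h r2)
  ext m
  constructor
  · rintro ⟨hc, hn, hm⟩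
    have hmn : m.Nodup := by grind
    obtain ⟨A, B, C, D, j1, j2, j3, rfl, hj⟩ := split3 (p := p) (q := q) (r := r) hmn
      (by have := hm p; grind) (by have := hm q; grind) (by have := hm r; grind) pq pr qr
    have hc' := hc
    rw [chain4] at hc'
    obtain ⟨c1, c2, c3, c4⟩ := hc'
    have s1 := seg c1 (by grind)
    have s2 := seg c2 (by grind)
    have s3 := seg c3 (by grind)
    have s4 := seg c4 (by grind)
    have s1 : (x :: (A ++ [j1])).IsChain R1 ∧ ∀ v ∈ x :: (A ++ [j1]), v ∈ V1 := by
      rcases s1 with h | h | h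
      · exact h
      · exact absurd (h.2 x (by simp)) hx2
      · exact absurd (h.2 x (by simp)) hx3
    have s4 : (j3 :: (D ++ [y])).IsChain R2 ∧ ∀ v ∈ j3 :: (D ++ [y]), v ∈ V2 := by
      rcases s4 with h | h | h
      · exact absurd (h.2 y (by simp)) hy1
      · exact h
      · exact absurd (h.2 y (by simp)) hy3
    have hj1 : j1 ∈ V1 := s1.2 _ (by simp)
    have hj3 : j3 ∈ V2 := s4.2 _ (by simp)
    have b2 : ∀ V : Set α, (∀ v ∈ j1 :: (B ++ [j2]), v ∈ V) → j1 ∈ V ∧ j2 ∈ V :=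
      fun V h => ⟨h _ (by simp), h _ (by simp)⟩
    have b3 : ∀ V : Set α, (∀ v ∈ j2 :: (C ++ [j3]), v ∈ V) → j2 ∈ V ∧ j3 ∈ V :=
      fun V h => ⟨h _ (by simp), h _ (by simp)⟩
    rcases hj with ⟨rfl, rfl, rfl⟩ | ⟨rfl, rfl, rfl⟩ | ⟨rfl, rfl, rfl⟩ | ⟨rfl, rfl, rfl⟩ |
      ⟨rfl, rfl, rfl⟩ | ⟨rfl, rfl, rfl⟩
    · left
      have s2 : (j1 :: (B ++ [j2])).IsChain R1 ∧ ∀ v ∈ j1 :: (B ++ [j2]), v ∈ V1 := by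
        rcases s2 with h | h | h
        · exact h
        · exact absurd (b2 _ h.2).2 hq2
        · exact absurd (b2 _ h.2).1 p3
      have s3 : (j2 :: (C ++ [j3])).IsChain R3 ∧ ∀ v ∈ j2 :: (C ++ [j3]), v ∈ V3 := by
        rcases s3 with h | h | h
        · exact absurd (b3 _ h.2).2 hr1
        · exact absurd (b3 _ h.2).1 hq2
        · exact h
      have N1 := nodup_split (A := A) hn
      have N2 := nodup_split (A := B) N1.2.1
      have N3 := nodup_split (A := C) N2.2.1
      have N4 := nodup_split (A := A ++ j1 :: B) (j := j2) (B := C ++ j3 :: D) (u := x) (y := y)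
        (by simpa using hn)
      refine ⟨(A ++ j1 :: B, C, D), ⟨⟨?_, ?_, ?_⟩, ⟨s3.1, ?_, ?_⟩, ⟨s4.1, ?_, ?_⟩⟩, by simp [join]⟩
      · rw [chain2]
        exact ⟨s1.1, s2.1⟩
      · exact N4.1
      · intro v
        have h := hm v
        have k1 := s1.2 v
        have k2 := s2.2 v
        have k3 := s3.2 v
        have k4 := s4.2 v
        have := hp v
        have := hq v
        have := hr v
        have := hT v
        clear hm hn hmn hc s1 s2 s3 s4 c1 c2 c3 c4 seg b2 b3 e1 e2 e3 hp hq hr hT N1 N2 N3 N4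
        simp only [List.mem_cons, List.mem_append, List.not_mem_nil, or_false, Set.mem_ofPred_eq]
          at h k1 k2 k3 k4 ⊢
        grind
      · exact N3.1
      · intro v
        have h := hm v
        have k1 := s1.2 v
        have k2 := s2.2 v
        have k3 := s3.2 v
        have k4 := s4.2 v
        have := hp v
        have := hq v
        have := hr v
        have := hT v
        clear hm hn hmn hc s1 s2 s3 s4 c1 c2 c3 c4 seg b2 b3 e1 e2 e3 hp hq hr hT N1 N2 N3 N4
        simp only [List.mem_cons, List.mem_append, List.not_mem_nil, or_false, Set.mem_ofPred_eq]
          at h k1 k2 k3 k4 ⊢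
        grind
      · exact N3.2.1
      · intro v
        have h := hm v
        have k1 := s1.2 v
        have k2 := s2.2 v
        have k3 := s3.2 v
        have k4 := s4.2 v
        have := hp v
        have := hq v
        have := hr v
        have := hT v
        have N := N4.2.2 j1 (by simp)
        simp only [List.mem_cons, List.mem_append, List.not_mem_nil, or_false] at N
        clear hm hn hmn hc s1 s2 s3 s4 c1 c2 c3 c4 seg b2 b3 e1 e2 e3 hp hq hr hT N1 N2 N3 N4
        simp only [List.mem_cons, List.mem_append, List.not_mem_nil, or_false, Set.mem_ofPred_eq,
          Set.mem_sdiff, Set.mem_singleton_iff] at h k1 k2 k3 k4 ⊢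
        grind
    · exact absurd hj3 hq2
    · right; right
      have s2 : (j1 :: (B ++ [j2])).IsChain R1 ∧ ∀ v ∈ j1 :: (B ++ [j2]), v ∈ V1 := by
        rcases s2 with h | h | h
        · exact h
        · exact absurd (b2 _ h.2).1 hq2
        · exact absurd (b2 _ h.2).2 p3
      have s3 : (j2 :: (C ++ [j3])).IsChain R2 ∧ ∀ v ∈ j2 :: (C ++ [j3]), v ∈ V2 := by
        rcases s3 with h | h | h
        · exact absurd (b3 _ h.2).2 hr1
        · exact h
        · exact absurd (b3 _ h.2).1 p3
      have N1 := nodup_split (A := A) hn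
      have N2 := nodup_split (A := B) N1.2.1
      have N3 := nodup_split (A := C) N2.2.1
      have N4 := nodup_split (A := A ++ j1 :: B) (j := j2) (B := C ++ j3 :: D) (u := x) (y := y)
        (by simpa using hn)
      refine ⟨⟨(A ++ j1 :: B, C ++ j3 :: D), ⟨⟨?_, ?_, ?_⟩, ⟨?_, ?_, ?_⟩⟩, by simp⟩, ?_⟩
      · rw [chain2]
        exact ⟨s1.1, s2.1⟩
      · exact N4.1
      · intro v
        have h := hm v
        have k1 := s1.2 v
        have k2 := s2.2 v
        have k3 := s3.2 v
        have k4 := s4.2 v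
        have := hp v
        have := hq v
        have := hr v
        have := hT v
        clear hm hn hmn hc s1 s2 s3 s4 c1 c2 c3 c4 seg b2 b3 e1 e2 e3 hp hq hr hT N1 N2 N3 N4
        simp only [List.mem_cons, List.mem_append, List.not_mem_nil, or_false, Set.mem_ofPred_eq]
          at h k1 k2 k3 k4 ⊢
        grind
      · rw [chain2]
        exact ⟨s3.1, s4.1⟩
      · exact N2.2.1
      · intro v
        have h := hm v
        have k1 := s1.2 v
        have k2 := s2.2 v
        have k3 := s3.2 v
        have k4 := s4.2 v
        have := hp v
        have := hq v
        have := hr v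
        have := hT v
        clear hm hn hmn hc s1 s2 s3 s4 c1 c2 c3 c4 seg b2 b3 e1 e2 e3 hp hq hr hT N1 N2 N3 N4
        simp only [List.mem_cons, List.mem_append, List.not_mem_nil, or_false, Set.mem_ofPred_eq]
          at h k1 k2 k3 k4 ⊢
        grind
      · ext v
        have h := hm v
        have k1 := s1.2 v
        have k2 := s2.2 v
        have k3 := s3.2 v
        have k4 := s4.2 v
        have := hp v
        have := hq v
        have := hr v
        have := hT v
        have : v = j1 → v ∈ T := fun h => h ▸ hqT
        have : v = j3 → v ∈ T := fun h => h ▸ hrT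
        clear hm hn hmn hc s1 s2 s3 s4 c1 c2 c3 c4 seg b2 b3 e1 e2 e3 hp hq hr hT N1 N2 N3 N4
        simp only [List.mem_cons, List.mem_append, List.not_mem_nil, or_false, Set.mem_ofPred_eq,
          Set.mem_singleton_iff, Set.mem_insert_iff] at h k1 k2 k3 k4 ⊢
        grind
    · right; left
      have s2 : (j1 :: (B ++ [j2])).IsChain R3 ∧ ∀ v ∈ j1 :: (B ++ [j2]), v ∈ V3 := by
        rcases s2 with h | h | h
        · exact absurd (b2 _ h.2).2 hr1
        · exact absurd (b2 _ h.2).1 hq2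
        · exact h
      have s3 : (j2 :: (C ++ [j3])).IsChain R2 ∧ ∀ v ∈ j2 :: (C ++ [j3]), v ∈ V2 := by
        rcases s3 with h | h | h
        · exact absurd (b3 _ h.2).1 hr1
        · exact h
        · exact absurd (b3 _ h.2).2 p3
      have N1 := nodup_split (A := A) hn
      have N2 := nodup_split (A := B) N1.2.1
      have N3 := nodup_split (A := C) N2.2.1
      have N4 := nodup_split (A := A ++ j1 :: B) (j := j2) (B := C ++ j3 :: D) (u := x) (y := y)
        (by simpa using hn)
      refine ⟨(A, B, C ++ j3 :: D), ⟨⟨s1.1, ?_, ?_⟩, ⟨s2.1, ?_, ?_⟩, ⟨?_, ?_, ?_⟩⟩, by simp [join]⟩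
      · exact N1.1
      · intro v
        have h := hm v
        have k1 := s1.2 v
        have k2 := s2.2 v
        have k3 := s3.2 v
        have k4 := s4.2 v
        have := hp v
        have := hq v
        have := hr v
        have := hT v
        have N : j3 ∉ x :: A := fun h => N1.2.2 j3 h (by simp)
        simp only [List.mem_cons] at N
        clear hm hn hmn hc s1 s2 s3 s4 c1 c2 c3 c4 seg b2 b3 e1 e2 e3 hp hq hr hT N1 N2 N3 N4
        simp only [List.mem_cons, List.mem_append, List.not_mem_nil, or_false, Set.mem_ofPred_eq,
          Set.mem_sdiff, Set.mem_singleton_iff] at h k1 k2 k3 k4 ⊢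
        grind
      · exact N2.1
      · intro v
        have h := hm v
        have k1 := s1.2 v
        have k2 := s2.2 v
        have k3 := s3.2 v
        have k4 := s4.2 v
        have := hp v
        have := hq v
        have := hr v
        have := hT v
        clear hm hn hmn hc s1 s2 s3 s4 c1 c2 c3 c4 seg b2 b3 e1 e2 e3 hp hq hr hT N1 N2 N3 N4
        simp only [List.mem_cons, List.mem_append, List.not_mem_nil, or_false, Set.mem_ofPred_eq]
          at h k1 k2 k3 k4 ⊢
        grind
      · rw [chain2]
        exact ⟨s3.1, s4.1⟩
      · exact N2.2.1
      · intro v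
        have h := hm v
        have k1 := s1.2 v
        have k2 := s2.2 v
        have k3 := s3.2 v
        have k4 := s4.2 v
        have := hp v
        have := hq v
        have := hr v
        have := hT v
        clear hm hn hmn hc s1 s2 s3 s4 c1 c2 c3 c4 seg b2 b3 e1 e2 e3 hp hq hr hT N1 N2 N3 N4
        simp only [List.mem_cons, List.mem_append, List.not_mem_nil, or_false, Set.mem_ofPred_eq]
          at h k1 k2 k3 k4 ⊢
        grind
    · exact absurd hj1 hr1
    · exact absurd hj1 hr1
  · rintro (⟨⟨A, B, C⟩, ⟨⟨c1, n1, m1⟩, ⟨c2, n2, m2⟩, ⟨c3, n3, m3⟩⟩, rfl⟩ |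
      ⟨⟨A, B, C⟩, ⟨⟨c1, n1, m1⟩, ⟨c2, n2, m2⟩, ⟨c3, n3, m3⟩⟩, rfl⟩ |
      ⟨⟨⟨A, B⟩, ⟨⟨c1, n1, m1⟩, ⟨c2, n2, m2⟩⟩, rfl⟩, hT2⟩)
    · dsimp only at *
      clear seg e1 e2 e3
      refine ⟨?_, ?_, ?_⟩
      · simp only [join]
        rw [chain3]
        exact ⟨c1.imp fun _ _ h => by tauto, c2.imp fun _ _ h => by tauto,
          c3.imp fun _ _ h => by tauto⟩
      · refine nodup_glue3 n1 n2 n3 ?_ ?_ ?_ <;> intro v <;> simp only [m1, m2, m3] <;>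
          clear m1 m2 m3 n1 n2 n3 c1 c2 c3 <;> grind
      · intro v
        have h1 := m1 v; have h2 := m2 v; have h3 := m3 v
        clear m1 m2 m3
        simp only [join, Set.mem_sdiff, Set.mem_singleton_iff, Set.mem_ofPred_eq,
          List.mem_cons, List.mem_append, List.not_mem_nil] at h1 h2 h3 ⊢
        clear n1 n2 n3 c1 c2 c3
        grind
    · dsimp only at *
      clear seg e1 e2 e3
      refine ⟨?_, ?_, ?_⟩
      · simp only [join]
        rw [chain3]
        exact ⟨c1.imp fun _ _ h => by tauto, c2.imp fun _ _ h => by tauto,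
          c3.imp fun _ _ h => by tauto⟩
      · refine nodup_glue3 n1 n2 n3 ?_ ?_ ?_ <;> intro v <;> simp only [m1, m2, m3] <;>
          clear m1 m2 m3 n1 n2 n3 c1 c2 c3 <;> grind
      · intro v
        have h1 := m1 v; have h2 := m2 v; have h3 := m3 v
        clear m1 m2 m3
        simp only [join, Set.mem_sdiff, Set.mem_singleton_iff, Set.mem_ofPred_eq,
          List.mem_cons, List.mem_append, List.not_mem_nil] at h1 h2 h3 ⊢
        clear n1 n2 n3 c1 c2 c3
        grind
    · dsimp only at *
      clear seg e1 e2 e3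
      refine ⟨?_, ?_, ?_⟩
      · rw [chain2]
        exact ⟨c1.imp fun _ _ h => by tauto, c2.imp fun _ _ h => by tauto⟩
      · refine nodup_glue2 n1 n2 ?_
        intro v
        simp only [m1, m2]
        exact hp v
      · intro v
        have h1 := m1 v; have h2 := m2 v
        clear m1 m2 n1 n2 c1 c2
        simp only [Set.mem_ofPred_eq, hT2, Set.mem_insert_iff, Set.mem_singleton_iff,
          List.mem_cons, List.mem_append, List.not_mem_nil] at h1 h2 ⊢
        grind

theorem Glue.hamCyc_eq (g : Glue V1 V2 V3 R1 R2 R3 p q r) :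
    HamCyc {v | v ∈ V1 ∨ v ∈ V2 ∨ v ∈ V3} (fun u v => R1 u v ∨ R2 u v ∨ R3 u v) q =
      join p r '' (Ham V1 R1 q p ×ˢ Ham V2 R2 p r ×ˢ Ham V3 R3 r q) ∪
      join r p '' (Ham V3 R3 q r ×ˢ Ham V2 R2 r p ×ˢ Ham V1 R1 p q) := by
  have seg := @Glue.segment' _ _ _ _ _ _ _ _ _ _ g
  obtain ⟨e1, e2, e3, p1, p2, q1, q3, r2, r3, hp, hq, hr, pq, pr, qr⟩ := g
  have p3 : p ∉ V3 := fun h => pq (hq _ p1 h)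
  have hq2 : q ∉ V2 := fun h => pq.symm (hp _ q1 h)
  have hr1 : r ∉ V1 := fun h => pr.symm (hp _ h r2)
  have two : ∀ {t : List α} {u v : α}, u ∈ t → v ∈ t → u ≠ v →
      ∃ A B C, t = A ++ u :: (B ++ v :: C) ∨ t = A ++ v :: (B ++ u :: C) := by
    intro t u v hu hv huv
    obtain ⟨s, t, rfl⟩ := List.append_of_mem hu
    have : v ∈ s ∨ v ∈ t := by grind
    rcases this with h | h
    · obtain ⟨s1, t1, rfl⟩ := List.append_of_mem h
      exact ⟨s1, t1, t, .inr (by simp)⟩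
    · obtain ⟨s1, t1, rfl⟩ := List.append_of_mem h
      exact ⟨s, s1, t1, .inl (by simp)⟩
  ext m
  constructor
  · rintro ⟨hc, hn, hm⟩
    obtain ⟨A, B, C, h⟩ := two (t := m) (u := p) (v := r)
      (by have := hm p; grind) (by have := hm r; grind) pr
    rcases h with rfl | rfl
    · left
      have hc' := hc
      rw [chain3] at hc'
      obtain ⟨c1, c2, c3⟩ := hc'
      have s1 := seg c1 (by grind)
      have s2 := seg c2 (by grind)
      have s3 := seg c3 (by grind)
      replace s1 := s1.resolve_right
        (by rintro (h | h); exacts [hq2 (h.2 _ (by simp)), p3 (h.2 _ (by simp))])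
      replace s2 := (s2.resolve_left (fun h => hr1 (h.2 _ (by simp)))).resolve_right
        (fun h => p3 (h.2 _ (by simp)))
      replace s3 := (s3.resolve_left (fun h => hr1 (h.2 _ (by simp)))).resolve_left
        (fun h => hq2 (h.2 _ (by simp)))
      have N1 := nodup_cyc_split hn
      have N2 := nodup_split (A := B) N1.2
      refine ⟨(A, B, C), ⟨⟨s1.1, ?_, ?_⟩, ⟨s2.1, ?_, ?_⟩, ⟨s3.1, ?_, ?_⟩⟩, by simp [join]⟩
      · exact N1.1
      · intro v
        have h := hm v
        have k1 := s1.2 v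
        have k2 := s2.2 v
        have k3 := s3.2 v
        have := hp v
        have := hq v
        have := hr v
        clear hm hn hc s1 s2 s3 c1 c2 c3 seg two e1 e2 e3 hp hq hr N1 N2
        simp only [List.mem_cons, List.mem_append, List.not_mem_nil, or_false, Set.mem_ofPred_eq]
          at h k1 k2 k3 ⊢
        grind
      · exact N2.1
      · intro v
        have h := hm v
        have k1 := s1.2 v
        have k2 := s2.2 v
        have k3 := s3.2 v
        have := hp v
        have := hq v
        have := hr v
        clear hm hn hc s1 s2 s3 c1 c2 c3 seg two e1 e2 e3 hp hq hr N1 N2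
        simp only [List.mem_cons, List.mem_append, List.not_mem_nil, or_false, Set.mem_ofPred_eq]
          at h k1 k2 k3 ⊢
        grind
      · exact N2.2.1
      · intro v
        have h := hm v
        have k1 := s1.2 v
        have k2 := s2.2 v
        have k3 := s3.2 v
        have := hp v
        have := hq v
        have := hr v
        clear hm hn hc s1 s2 s3 c1 c2 c3 seg two e1 e2 e3 hp hq hr N1 N2
        simp only [List.mem_cons, List.mem_append, List.not_mem_nil, or_false, Set.mem_ofPred_eq]
          at h k1 k2 k3 ⊢
        grind
    · right
      have hc' := hc
      rw [chain3] at hc'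
      obtain ⟨c1, c2, c3⟩ := hc'
      have s1 := seg c1 (by grind)
      have s2 := seg c2 (by grind)
      have s3 := seg c3 (by grind)
      replace s3 := s3.resolve_right
        (by rintro (h | h); exacts [hq2 (h.2 _ (by simp)), p3 (h.2 _ (by simp))])
      replace s2 := (s2.resolve_left (fun h => hr1 (h.2 _ (by simp)))).resolve_right
        (fun h => p3 (h.2 _ (by simp)))
      replace s1 := (s1.resolve_left (fun h => hr1 (h.2 _ (by simp)))).resolve_left
        (fun h => hq2 (h.2 _ (by simp)))
      have N1 := nodup_cyc_split hn
      have N2 := nodup_split (A := B) N1.2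
      refine ⟨(A, B, C), ⟨⟨s1.1, ?_, ?_⟩, ⟨s2.1, ?_, ?_⟩, ⟨s3.1, ?_, ?_⟩⟩, by simp [join]⟩
      · exact N1.1
      · intro v
        have h := hm v
        have k1 := s1.2 v
        have k2 := s2.2 v
        have k3 := s3.2 v
        have := hp v
        have := hq v
        have := hr v
        clear hm hn hc s1 s2 s3 c1 c2 c3 seg two e1 e2 e3 hp hq hr N1 N2
        simp only [List.mem_cons, List.mem_append, List.not_mem_nil, or_false, Set.mem_ofPred_eq]
          at h k1 k2 k3 ⊢
        grind
      · exact N2.1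
      · intro v
        have h := hm v
        have k1 := s1.2 v
        have k2 := s2.2 v
        have k3 := s3.2 v
        have := hp v
        have := hq v
        have := hr v
        clear hm hn hc s1 s2 s3 c1 c2 c3 seg two e1 e2 e3 hp hq hr N1 N2
        simp only [List.mem_cons, List.mem_append, List.not_mem_nil, or_false, Set.mem_ofPred_eq]
          at h k1 k2 k3 ⊢
        grind
      · exact N2.2.1
      · intro v
        have h := hm v
        have k1 := s1.2 v
        have k2 := s2.2 v
        have k3 := s3.2 v
        have := hp v
        have := hq v
        have := hr v
        clear hm hn hc s1 s2 s3 c1 c2 c3 seg two e1 e2 e3 hp hq hr N1 N2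
        simp only [List.mem_cons, List.mem_append, List.not_mem_nil, or_false, Set.mem_ofPred_eq]
          at h k1 k2 k3 ⊢
        grind
  · rintro (⟨⟨A, B, C⟩, ⟨⟨c1, n1, m1⟩, ⟨c2, n2, m2⟩, ⟨c3, n3, m3⟩⟩, rfl⟩ |
      ⟨⟨A, B, C⟩, ⟨⟨c1, n1, m1⟩, ⟨c2, n2, m2⟩, ⟨c3, n3, m3⟩⟩, rfl⟩)
    all_goals
      dsimp only at *
      clear seg two e1 e2 e3
      refine ⟨?_, ?_, ?_⟩
      · simp only [join]
        rw [chain3]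
        exact ⟨c1.imp fun _ _ h => by tauto, c2.imp fun _ _ h => by tauto,
          c3.imp fun _ _ h => by tauto⟩
      · refine nodup_cyc3 n1 n2 n3 ?_ ?_ ?_ <;> intro v <;> simp only [m1, m2, m3] <;>
          clear m1 m2 m3 n1 n2 n3 c1 c2 c3 <;> grind
      · intro v
        have h1 := m1 v; have h2 := m2 v; have h3 := m3 v
        clear m1 m2 m3
        simp only [join, Set.mem_ofPred_eq, List.mem_cons, List.mem_append, List.not_mem_nil]
          at h1 h2 h3 ⊢
        clear n1 n2 n3 c1 c2 c3
        grind

theorem ncard_of_list {l : List α} {V : Set α} (hn : l.Nodup) (h : ∀ v, v ∈ l ↔ v ∈ V) :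
    V.ncard = l.length := by
  have : V = (l.toFinset : Set α) := by ext v; simp [h]
  rw [this, Set.ncard_coe_finset, List.toFinset_card_of_nodup hn]

theorem length_of_mem_ham {V : Set α} {R : α → α → Prop} {m : List α} (h : m ∈ Ham V R x y) :
    m.length + 2 = V.ncard := by
  rw [ncard_of_list h.2.1 h.2.2]; simp

theorem finite_ham {V : Set α} (hV : V.Finite) {R : α → α → Prop} : (Ham V R x y).Finite := by
  refine Set.Finite.of_injOn (f := fun m => x :: (m ++ [y]))
    (t := {l | l ∈ hV.toFinset.toList.permutations}) ?_ ?_ (List.finite_toSet _)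
  · intro m hm
    simp only [Set.mem_ofPred_eq, List.mem_permutations]
    rw [List.perm_ext_iff_of_nodup hm.2.1 (Finset.nodup_toList _)]
    intro v
    rw [hm.2.2 v]
    simp
  · intro m _ m' _ h
    simpa using h

theorem finite_hamCyc {V : Set α} (hV : V.Finite) {R : α → α → Prop} : (HamCyc V R x).Finite := by
  refine Set.Finite.of_injOn (f := fun m => x :: m)
    (t := {l | l ∈ hV.toFinset.toList.permutations}) ?_ ?_ (List.finite_toSet _)
  · intro m hm
    simp only [Set.mem_ofPred_eq, List.mem_permutations]
    rw [List.perm_ext_iff_of_nodup hm.2.1 (Finset.nodup_toList _)]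
    intro v
    rw [hm.2.2 v]
    simp
  · intro m _ m' _ h
    simpa using h

theorem ncard_join {A B C : Set (List α)} {a b : ℕ} (hA : ∀ m ∈ A, m.length = a)
    (hB : ∀ m ∈ B, m.length = b) {u w : α} :
    (join u w '' (A ×ˢ B ×ˢ C)).ncard = A.ncard * B.ncard * C.ncard := by
  rw [Set.InjOn.ncard_image, Set.ncard_prod, Set.ncard_prod, mul_assoc]
  rintro ⟨m1, m2, m3⟩ ⟨h1, h2, h3⟩ ⟨n1, n2, n3⟩ ⟨h1', h2', h3'⟩ h
  simp only [join] at h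
  obtain ⟨rfl, e⟩ := List.append_inj h ((hA _ h1).trans (hA _ h1').symm)
  obtain ⟨rfl, e'⟩ := List.append_inj (List.cons.inj e).2 ((hB _ h2).trans (hB _ h2').symm)
  rw [(List.cons.inj e').2]

theorem ncard_join_ham {W1 W2 W3 : Set α} {u w x1 x2 x3 y1 y2 y3 : α} :
    (join u w '' (Ham W1 R1 x1 y1 ×ˢ Ham W2 R2 x2 y2 ×ˢ Ham W3 R3 x3 y3)).ncard =
      (Ham W1 R1 x1 y1).ncard * (Ham W2 R2 x2 y2).ncard * (Ham W3 R3 x3 y3).ncard :=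
  ncard_join (a := W1.ncard - 2) (b := W2.ncard - 2)
    (fun _ h => by have := length_of_mem_ham h; omega)
    (fun _ h => by have := length_of_mem_ham h; omega)

theorem before_unique {u : α} {s t s' t' : List α} (hn : (s ++ u :: t).Nodup)
    (h : s ++ u :: t = s' ++ u :: t') : s = s' := by
  have hn' := h ▸ hn
  rw [List.nodup_append, List.nodup_cons] at hn hn'
  have h1 : u ∉ s := fun hu => hn.2.2 u hu u (by simp) rfl
  exact ((List.append_cons_inj_of_notMem h1 hn.2.1.1).1 h).1

theorem not_mem_of_mem_ham {V : Set α} {R : α → α → Prop} {m : List α} (h : m ∈ Ham V R x y) :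
    x ∉ m ∧ y ∉ m := by
  have := h.2.1
  rw [List.nodup_cons, List.nodup_append] at this
  exact ⟨fun h => this.1 (by simp [h]), fun h => this.2.2.2 y h y (by simp) rfl⟩

theorem mem_iff_of_mem_ham {V : Set α} {R : α → α → Prop} {m : List α} (h : m ∈ Ham V R x y)
    {v : α} :
    v ∈ m ↔ v ∈ V ∧ v ≠ x ∧ v ≠ y := by
  have h1 := not_mem_of_mem_ham h
  have := h.2.2 v
  simp only [List.mem_cons, List.mem_append, List.not_mem_nil, or_false] at this
  rw [← this]
  constructor
  · intro hv
    exact ⟨by tauto, by rintro rfl; tauto, by rintro rfl; tauto⟩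
  · tauto

theorem Glue.ham_ncard (g : Glue V1 V2 V3 R1 R2 R3 p q r) {T : Set α} (hT : ∀ v ∈ T, v ∈ V3)
    (f1 : V1.Finite) (f2 : V2.Finite) (f3 : T.Finite)
    (hqT : q ∈ T) (hrT : r ∈ T) (hx : x ∈ V1) (xp : x ≠ p) (xq : x ≠ q)
    (hy : y ∈ V2) (yp : y ≠ p) (yr : y ≠ r) :
    (Ham {v | v ∈ V1 ∨ v ∈ V2 ∨ v ∈ T} (fun u v => R1 u v ∨ R2 u v ∨ R3 u v) x y).ncard =
      (Ham V1 R1 x q).ncard * (Ham T R3 q r).ncard * (Ham (V2 \ {p}) R2 r y).ncard +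
      ((Ham (V1 \ {p}) R1 x q).ncard * (Ham T R3 q r).ncard * (Ham V2 R2 r y).ncard +
      if T = {q, r} then (Ham V1 R1 x p).ncard * (Ham V2 R2 p y).ncard else 0) := by
  have e := g.ham_eq hT hqT hrT hx xp xq hy yp yr
  have fin : (Ham {v | v ∈ V1 ∨ v ∈ V2 ∨ v ∈ T} (fun u v => R1 u v ∨ R2 u v ∨ R3 u v) x y).Finite :=
    finite_ham (f1.union (f2.union f3))
  have nod : ∀ m ∈ Ham {v | v ∈ V1 ∨ v ∈ V2 ∨ v ∈ T} (fun u v => R1 u v ∨ R2 u v ∨ R3 u v) x y,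
      m.Nodup := by
    intro m hm
    have := hm.2.1
    rw [List.nodup_cons, List.nodup_append] at this
    exact this.2.1
  rw [e] at fin nod ⊢
  have fin1 := Set.finite_union.1 fin
  have fin2 := Set.finite_union.1 fin1.2
  have p1 := g.p1
  have p2 := g.p2
  have pq := g.pq
  have pr := g.pr
  have qr := g.qr
  rw [Set.ncard_union_eq _ fin1.1 fin1.2, Set.ncard_union_eq _ fin2.1 fin2.2, ncard_join_ham,
    ncard_join_ham]
  · congr 2
    split_ifs with h
    · simp only [h, and_true]
      rw [← Set.ncard_prod]
      apply Set.InjOn.ncard_image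
      rintro ⟨m1, m2⟩ ⟨h1, h2⟩ ⟨n1, n2⟩ ⟨h1', h2'⟩ h
      obtain ⟨rfl, h⟩ := List.append_inj h
        (by have := length_of_mem_ham h1; have := length_of_mem_ham h1'; dsimp only at *; omega)
      simpa using h
    · simp [h]
  · rw [Set.disjoint_left]
    rintro m hm ⟨⟨⟨A, B⟩, ⟨h1, h2⟩, rfl⟩, -⟩
    have hn := nod _ (.inr (.inl hm))
    obtain ⟨⟨A', B', C'⟩, ⟨h1', h2', h3'⟩, h⟩ := hm
    dsimp only [join] at h h1 h2 h1' h2' h3' hn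
    obtain ⟨C1, C2, rfl⟩ := List.append_of_mem
      ((mem_iff_of_mem_ham h3').2 ⟨p2, pr, yp.symm⟩)
    have := before_unique (s' := A' ++ q :: (B' ++ r :: C1)) (t' := C2) hn (by simp [← h])
    have : r ∈ A := by simp [this]
    exact pr ((g.hp _ ((mem_iff_of_mem_ham h1).1 this).1 g.r2).symm)
  · rw [Set.disjoint_left]
    intro m hm
    have hn := nod _ (.inl hm)
    obtain ⟨⟨A', B', C'⟩, ⟨h1', h2', h3'⟩, rfl⟩ := hm
    dsimp only [join] at h1' h2' h3' hn
    have hpA := (mem_iff_of_mem_ham h1').2 ⟨p1, xp.symm, pq⟩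
    rintro (⟨⟨A, B, C⟩, ⟨h1, h2, h3⟩, h⟩ | ⟨⟨⟨A, B⟩, ⟨h1, h2⟩, h⟩, -⟩)
    · dsimp only [join] at h h1
      have := before_unique hn h.symm
      subst this
      exact ((mem_iff_of_mem_ham h1).1 hpA).1.2 rfl
    · dsimp only [join] at h h1
      have hqA := (mem_iff_of_mem_ham h1).2 ⟨g.q1, xq.symm, pq.symm⟩
      obtain ⟨A1, A2, rfl⟩ := List.append_of_mem hpA
      have := before_unique (s := A1) (u := p) (s' := A) (by simpa using hn) (by rw [h]; simp)
      subst this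
      exact (not_mem_of_mem_ham h1').2 (by simp [hqA])

theorem Glue.hamCyc_ncard (g : Glue V1 V2 V3 R1 R2 R3 p q r)
    (f1 : V1.Finite) (f2 : V2.Finite) (f3 : V3.Finite) :
    (HamCyc {v | v ∈ V1 ∨ v ∈ V2 ∨ v ∈ V3} (fun u v => R1 u v ∨ R2 u v ∨ R3 u v) q).ncard =
      (Ham V1 R1 q p).ncard * (Ham V2 R2 p r).ncard * (Ham V3 R3 r q).ncard +
      (Ham V3 R3 q r).ncard * (Ham V2 R2 r p).ncard * (Ham V1 R1 p q).ncard := by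
  have e := g.hamCyc_eq
  have fin : (HamCyc {v | v ∈ V1 ∨ v ∈ V2 ∨ v ∈ V3}
      (fun u v => R1 u v ∨ R2 u v ∨ R3 u v) q).Finite :=
    finite_hamCyc (f1.union (f2.union f3))
  have nod : ∀ m ∈ HamCyc {v | v ∈ V1 ∨ v ∈ V2 ∨ v ∈ V3} (fun u v => R1 u v ∨ R2 u v ∨ R3 u v) q,
      m.Nodup := fun m hm => (List.nodup_cons.1 hm.2.1).2
  rw [e] at fin nod ⊢
  have fin1 := Set.finite_union.1 fin
  rw [Set.ncard_union_eq _ fin1.1 fin1.2, ncard_join_ham, ncard_join_ham]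
  rw [Set.disjoint_left]
  intro m hm
  have hn := nod _ (.inl hm)
  obtain ⟨⟨A', B', C'⟩, ⟨h1', h2', h3'⟩, rfl⟩ := hm
  rintro ⟨⟨A, B, C⟩, ⟨h1, h2, h3⟩, h⟩
  dsimp only [join] at h h1 h1' hn
  have := before_unique (s' := A ++ r :: B) (t' := C) hn (by simp [← h])
  have : r ∈ A' := by simp [this]
  exact g.pr ((g.hp _ ((mem_iff_of_mem_ham h1').1 this).1 g.r2).symm)

theorem ncard_hamCyc_le {V : Set α} (hV : V.Finite) {R : α → α → Prop} (hy : y ∈ V)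
    (hxy : x ≠ y) : (HamCyc V R x).ncard ≤ (HamCyc V R y).ncard := by
  have key : ∀ m ∈ HamCyc V R x, ∃ s t, m = s ++ y :: t := fun m hm =>
    List.append_of_mem (by have := (hm.2.2 y).2 hy; simpa [hxy.symm] using this)
  choose! s t hst using key
  refine Set.ncard_le_ncard_of_injOn (fun m => t m ++ x :: s m) ?_ ?_ (finite_hamCyc hV)
  · intro m hm
    have h := hst m hm
    obtain ⟨hc, hn, hm'⟩ := hm
    generalize s m = s at *
    generalize t m = t at *
    subst h
    rw [chain2] at hc
    have hp : (y :: (t ++ x :: s)).Perm (x :: (s ++ y :: t)) := by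
      have : (y :: t ++ x :: s).Perm (x :: s ++ y :: t) := List.perm_append_comm
      simpa using this
    refine ⟨?_, hp.nodup_iff.2 hn, fun v => hp.mem_iff.trans (hm' v)⟩
    rw [chain2]
    exact hc.symm
  · intro m hm m' hm' h
    dsimp only at h
    have h1 := (List.nodup_cons.1 hm.2.1).1
    have h2 := (List.nodup_cons.1 hm'.2.1).1
    rw [hst m hm] at h1 ⊢
    rw [hst m' hm'] at h2 ⊢
    simp only [List.mem_append, List.mem_cons, not_or] at h1 h2
    rw [List.append_cons_inj_of_notMem h1.2.2 h1.1] at h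
    rw [h.1, h.2.2]

theorem ncard_hamCyc_eq {V : Set α} (hV : V.Finite) {R : α → α → Prop} (hx : x ∈ V) (hy : y ∈ V)
    (hxy : x ≠ y) : (HamCyc V R x).ncard = (HamCyc V R y).ncard :=
  le_antisymm (ncard_hamCyc_le hV hy hxy) (ncard_hamCyc_le hV hx hxy.symm)

/-- `Gas n V R x y z`: the graph on `V` with adjacency relation `R` is a level-`n` Sierpinski gasket
with corners `x`, `y`, `z`. -/
inductive Gas : ℕ → Set α → (α → α → Prop) → α → α → α → Prop
  | zero {V : Set α} {R : α → α → Prop} {x y z : α} (xy : x ≠ y) (xz : x ≠ z) (yz : y ≠ z)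
      (hV : ∀ v, v ∈ V ↔ v = x ∨ v = y ∨ v = z) (hR : ∀ u v, R u v ↔ u ∈ V ∧ v ∈ V ∧ u ≠ v) :
      Gas 0 V R x y z
  | succ {n : ℕ} {V V1 V2 V3 : Set α} {R R1 R2 R3 : α → α → Prop} {p q r x y z : α}
      (g1 : Gas n V1 R1 x p q) (g2 : Gas n V2 R2 p y r) (g3 : Gas n V3 R3 q r z)
      (hp : ∀ v, v ∈ V1 → v ∈ V2 → v = p) (hq : ∀ v, v ∈ V1 → v ∈ V3 → v = q)
      (hr : ∀ v, v ∈ V2 → v ∈ V3 → v = r)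
      (hV : ∀ v, v ∈ V ↔ v ∈ V1 ∨ v ∈ V2 ∨ v ∈ V3)
      (hR : ∀ u v, R u v ↔ R1 u v ∨ R2 u v ∨ R3 u v) :
      Gas (n + 1) V R x y z

namespace Gas
variable {n : ℕ} {V : Set α} {R : α → α → Prop}

theorem swap (h : Gas n V R x y z) : Gas n V R y x z := by
  induction h with
  | zero xy xz yz hV hR => exact .zero xy.symm yz xz (fun v => by rw [hV]; tauto) hR
  | succ g1 g2 g3 hp hq hr hV hR ih1 ih2 ih3 =>
    exact .succ ih2 ih1 ih3 (fun v h1 h2 => hp v h2 h1) hr hq (fun v => by rw [hV]; tauto)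
      (fun u v => by rw [hR]; tauto)

theorem swap_right (h : Gas n V R x y z) : Gas n V R x z y := by
  induction h with
  | zero xy xz yz hV hR => exact .zero xz xy yz.symm (fun v => by rw [hV]; tauto) hR
  | succ g1 g2 g3 hp hq hr hV hR ih1 ih2 ih3 =>
    exact .succ ih1 ih3 ih2 hq hp (fun v h1 h2 => hr v h2 h1) (fun v => by rw [hV]; tauto)
      (fun u v => by rw [hR]; tauto)

theorem left_mem (h : Gas n V R x y z) : x ∈ V := by
  induction h with
  | zero xy xz yz hV hR => simp [hV]
  | succ g1 g2 g3 hp hq hr hV hR ih1 ih2 ih3 => simp [hV, ih1]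

theorem mid_mem (h : Gas n V R x y z) : y ∈ V := h.swap.left_mem

theorem right_mem (h : Gas n V R x y z) : z ∈ V := h.swap_right.mid_mem

theorem left_ne_mid (h : Gas n V R x y z) : x ≠ y := by
  induction h with
  | zero xy xz yz hV hR => exact xy
  | succ g1 g2 g3 hp hq hr hV hR ih1 ih2 ih3 =>
    rintro rfl
    exact ih1 (hp _ g1.left_mem g2.mid_mem)

theorem left_ne_right (h : Gas n V R x y z) : x ≠ z := h.swap_right.left_ne_mid

theorem mid_ne_right (h : Gas n V R x y z) : y ≠ z := h.swap.left_ne_right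

theorem mem_of_rel (h : Gas n V R x y z) (u v : α) (huv : R u v) : u ∈ V ∧ v ∈ V := by
  induction h with
  | zero xy xz yz hV hR => exact ⟨((hR u v).1 huv).1, ((hR u v).1 huv).2.1⟩
  | succ g1 g2 g3 hp hq hr hV hR ih1 ih2 ih3 =>
    rw [hV, hV]
    rcases (hR u v).1 huv with h | h | h
    · exact ⟨.inl (ih1 h).1, .inl (ih1 h).2⟩
    · exact ⟨.inr (.inl (ih2 h).1), .inr (.inl (ih2 h).2)⟩
    · exact ⟨.inr (.inr (ih3 h).1), .inr (.inr (ih3 h).2)⟩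

theorem finite (h : Gas n V R x y z) : V.Finite := by
  induction h with
  | @zero V R x y z xy xz yz hV hR =>
    exact (Set.toFinite {x, y, z}).subset fun v hv => by simpa using (hV v).1 hv
  | succ g1 g2 g3 hp hq hr hV hR ih1 ih2 ih3 =>
    exact (ih1.union (ih2.union ih3)).subset fun v hv => (hV v).1 hv

theorem exists_not_corner (h : Gas (n + 1) V R x y z) : ∃ v ∈ V, v ≠ x ∧ v ≠ y ∧ v ≠ z := by
  cases h with
  | @succ n V V1 V2 V3 R R1 R2 R3 p q r x y z g1 g2 g3 hp hq hr hV hR =>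
    refine ⟨p, (hV p).2 (.inl g1.mid_mem), g1.left_ne_mid.symm, g2.left_ne_mid, ?_⟩
    rintro rfl
    exact g1.mid_ne_right (hq _ g1.mid_mem g3.right_mem)

theorem translate {β : Type*} [AddGroup β] {n : ℕ} {V : Set β} {R : β → β → Prop} {x y z : β}
    (h : Gas n V R x y z) (t : β) :
    Gas n {v | v - t ∈ V} (fun u v => R (u - t) (v - t)) (x + t) (y + t) (z + t) := by
  induction h with
  | zero xy xz yz hV hR =>
    exact .zero (by simpa) (by simpa) (by simpa) (fun v => by simp [hV, sub_eq_iff_eq_add])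
      (fun u v => by simp [hR])
  | succ g1 g2 g3 hp hq hr hV hR ih1 ih2 ih3 =>
    refine .succ ih1 ih2 ih3 ?_ ?_ ?_ (fun v => hV _) (fun u v => hR _ _) <;> intro v h1 h2
    · exact sub_eq_iff_eq_add.1 (hp _ h1 h2)
    · exact sub_eq_iff_eq_add.1 (hq _ h1 h2)
    · exact sub_eq_iff_eq_add.1 (hr _ h1 h2)

theorem glue (g1 : Gas n V1 R1 x p q) (g2 : Gas n V2 R2 p y r) (g3 : Gas n V3 R3 q r z)
    (hp : ∀ v, v ∈ V1 → v ∈ V2 → v = p) (hq : ∀ v, v ∈ V1 → v ∈ V3 → v = q)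
    (hr : ∀ v, v ∈ V2 → v ∈ V3 → v = r) : Glue V1 V2 V3 R1 R2 R3 p q r where
  e1 := g1.mem_of_rel
  e2 := g2.mem_of_rel
  e3 := g3.mem_of_rel
  p1 := g1.mid_mem
  p2 := g2.left_mem
  q1 := g1.right_mem
  q3 := g3.left_mem
  r2 := g2.right_mem
  r3 := g3.mid_mem
  hp := hp
  hq := hq
  hr := hr
  pq := g1.mid_ne_right
  pr := g2.left_ne_right
  qr := g3.left_ne_mid

end Gas

/-- the numbers of Hamiltonian paths joining two corners of a level-`n` gasket, in the whole gasket
and in the gasket with the third corner deleted. -/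
def hamCount : ℕ → ℕ × ℕ
  | 0 => (1, 1)
  | n + 1 => (2 * (hamCount n).1 ^ 2 * (hamCount n).2,
      2 * (hamCount n).1 * (hamCount n).2 ^ 2 + if n = 0 then (hamCount n).1 ^ 2 else 0)

theorem Gas.ham_ncard_zero {V : Set α} {R : α → α → Prop} (h : Gas 0 V R x y z) :
    (Ham V R x y).ncard = 1 ∧ (Ham (V \ {z}) R x y).ncard = 1 := by
  cases h with
  | zero xy xz yz hV hR =>
    constructor
    · rw [Set.ncard_eq_one]
      refine ⟨[z], Set.eq_singleton_iff_unique_mem.2 ⟨⟨?_, ?_, ?_⟩, ?_⟩⟩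
      · simp [hR, hV, xz, yz.symm]
      · simp [xy, xz, yz.symm]
      · intro v; simp [hV]; tauto
      · intro m hm
        have h := mem_iff_of_mem_ham hm (v := z)
        have l := length_of_mem_ham hm
        rw [ncard_of_list (l := [x, y, z]) (by simp [*]) (by simp [hV])] at l
        obtain ⟨v, rfl⟩ := List.length_eq_one_iff.1 (show m.length = 1 by simpa using l)
        have := h.2 ⟨by simp [hV], xz.symm, yz.symm⟩
        simp_all
    · rw [Set.ncard_eq_one]
      refine ⟨[], Set.eq_singleton_iff_unique_mem.2 ⟨⟨?_, ?_, ?_⟩, ?_⟩⟩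
      · simp [hR, hV, xy]
      · simp [xy]
      · intro v
        simp only [List.nil_append, List.mem_cons, List.not_mem_nil, or_false, Set.mem_sdiff, hV,
          Set.mem_singleton_iff]
        constructor
        · rintro (rfl | rfl) <;> simp [*]
        · tauto
      · intro m hm
        have l := length_of_mem_ham hm
        rw [ncard_of_list (l := [x, y]) (by simp [*])] at l
        · exact List.length_eq_zero_iff.1 (by simpa using l)
        · intro v
          simp only [List.mem_cons, List.not_mem_nil, or_false, Set.mem_sdiff, hV,
            Set.mem_singleton_iff]
          constructor
          · rintro (rfl | rfl) <;> simp [*]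
          · tauto

theorem Gas.ham_ncard {n : ℕ} {V : Set α} {R : α → α → Prop} (h : Gas n V R x y z) :
    (Ham V R x y).ncard = (hamCount n).1 ∧ (Ham (V \ {z}) R x y).ncard = (hamCount n).2 := by
  induction n generalizing V R x y z with
  | zero => exact h.ham_ncard_zero
  | succ n ih =>
    cases h with
    | @succ _ _ V1 V2 V3 _ R1 R2 R3 p q r _ _ _ g1 g2 g3 hp hq hr hV hR =>
    have g := Gas.glue g1 g2 g3 hp hq hr
    have hRe : R = fun u v => R1 u v ∨ R2 u v ∨ R3 u v := by
      funext u v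
      exact propext (hR u v)
    have z1 : z ∉ V1 := fun h => g3.left_ne_right (hq _ h g3.right_mem).symm
    have z2 : z ∉ V2 := fun h => g3.mid_ne_right (hr _ h g3.right_mem).symm
    have hVe : V = {v | v ∈ V1 ∨ v ∈ V2 ∨ v ∈ V3} := by
      ext v
      exact hV v
    have hVd : V \ {z} = {v | v ∈ V1 ∨ v ∈ V2 ∨ v ∈ V3 \ {z}} := by
      ext v
      simp only [Set.mem_sdiff, hV, Set.mem_singleton_iff, Set.mem_ofPred_eq]
      by_cases hv : v = z
      · subst hv; tauto
      · tauto
    rw [hVd, hVe, hRe]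
    have c1 := ih g1
    have c1' := ih g1.swap_right
    have c2 := ih g2
    have c2' := ih g2.swap_right.swap.swap_right
    have c3 := ih g3
    rw [g.ham_ncard (fun v h => h) g1.finite g2.finite g3.finite g3.left_mem g3.mid_mem
        g1.left_mem g1.left_ne_mid g1.left_ne_right g2.mid_mem g2.left_ne_mid.symm g2.mid_ne_right,
      g.ham_ncard (fun v h => h.1) g1.finite g2.finite (g3.finite.subset Set.sdiff_subset)
        ⟨g3.left_mem, g3.left_ne_right⟩ ⟨g3.mid_mem, g3.mid_ne_right⟩
        g1.left_mem g1.left_ne_mid g1.left_ne_right g2.mid_mem g2.left_ne_mid.symm g2.mid_ne_right]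
    have n3 : V3 ≠ {q, r} := by
      intro h
      have := g3.right_mem
      rw [h] at this
      rcases this with h | h
      · exact g3.left_ne_right h.symm
      · exact g3.mid_ne_right h.symm
    have n3' : V3 \ {z} = {q, r} ↔ n = 0 := by
      constructor
      · intro h
        cases n with
        | zero => rfl
        | succ n =>
          obtain ⟨v, hv, vq, vr, vz⟩ := g3.exists_not_corner
          have : v ∈ V3 \ {z} := ⟨hv, vz⟩
          rw [h] at this
          rcases this with h | h <;> contradiction
      · rintro rfl
        cases g3 with
        | zero xy xz yz hV hR =>
          ext v
          simp only [Set.mem_sdiff, hV, Set.mem_singleton_iff, Set.mem_insert_iff]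
          constructor
          · tauto
          · rintro (rfl | rfl) <;> simp [*]
    simp only [n3, n3', hamCount, c1, c1', c2, c2', c3, if_false]
    constructor
    · ring
    · split_ifs <;> ring

theorem Gas.hamCyc_ncard {n : ℕ} {V : Set α} {R : α → α → Prop} (h : Gas (n + 1) V R x y z) :
    (HamCyc V R x).ncard = 2 * (hamCount n).1 ^ 3 := by
  have fin := h.finite
  have hx := h.left_mem
  cases h with
  | @succ _ _ V1 V2 V3 _ R1 R2 R3 p q r _ _ _ g1 g2 g3 hp hq hr hV hR =>
  have g := Gas.glue g1 g2 g3 hp hq hr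
  have hRe : R = fun u v => R1 u v ∨ R2 u v ∨ R3 u v := by
    funext u v
    exact propext (hR u v)
  have hVe : V = {v | v ∈ V1 ∨ v ∈ V2 ∨ v ∈ V3} := by
    ext v
    exact hV v
  rw [ncard_hamCyc_eq fin hx ((hV q).2 (.inl g.q1)) g1.left_ne_right, hVe, hRe,
    g.hamCyc_ncard g1.finite g2.finite g3.finite,
    g1.swap.swap_right.ham_ncard.1, g1.swap.swap_right.swap.ham_ncard.1,
    g2.swap_right.ham_ncard.1, g2.swap_right.swap.ham_ncard.1,
    g3.ham_ncard.1, g3.swap.ham_ncard.1]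
  ring

end Gluing

theorem sq3_pos : 0 < sq3 := Real.sqrt_pos.2 (by norm_num)

theorem mem_image_add {S : Set (ℝ × ℝ)} {t v : ℝ × ℝ} : v ∈ (· + t) '' S ↔ v - t ∈ S := by
  simp [sub_eq_add_neg]

theorem mk_mem_image_add {S : Set (Sym2 (ℝ × ℝ))} {t u v : ℝ × ℝ} :
    s(u, v) ∈ Sym2.map (· + t) '' S ↔ s(u - t, v - t) ∈ S := by
  constructor
  · rintro ⟨e, he, h⟩
    have := congrArg (Sym2.map (· - t)) h
    rw [Sym2.map_map] at this
    have e' : ((· - t) ∘ (· + t) : ℝ × ℝ → ℝ × ℝ) = id := by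
      funext x
      simp
    rw [e', Sym2.map_id] at this
    simp only [Sym2.map_mk, id] at this
    rwa [this] at he
  · exact fun h => ⟨_, h, by simp⟩

theorem region {n : ℕ} {v : ℝ × ℝ} (hv : v ∈ V n) :
    0 ≤ v.2 ∧ v.2 ≤ sq3 * v.1 ∧ v.2 ≤ sq3 * (2 ^ n - v.1) := by
  have h3 := sq3_pos
  induction n generalizing v with
  | zero =>
    rcases hv with rfl | rfl | rfl <;> simp only [o, a, b] <;> refine ⟨?_, ?_, ?_⟩ <;> nlinarith
  | succ n ih =>
    have hs : 0 < sq3 * 2 ^ n := by positivity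
    rw [pow_succ]
    rcases hv with (hv | hv) | hv
    · obtain ⟨h1, h2, h3⟩ := ih hv
      exact ⟨h1, h2, by linarith⟩
    · obtain ⟨h1, h2, h3⟩ := ih (mem_image_add.1 hv)
      simp only [a, Prod.fst_sub, Prod.snd_sub] at h1 h2 h3
      refine ⟨by linarith, by linarith, by linarith⟩
    · obtain ⟨h1, h2, h3⟩ := ih (mem_image_add.1 hv)
      simp only [b, Prod.fst_sub, Prod.snd_sub] at h1 h2 h3
      refine ⟨by linarith, by linarith, by linarith⟩

theorem eq_of_mem_inter_a {n : ℕ} {v : ℝ × ℝ} (h : v ∈ V n) (h' : v - a n ∈ V n) : v = a n := by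
  have h3 := sq3_pos
  obtain ⟨h1, h2, h4⟩ := region h
  obtain ⟨h1', h2', h4'⟩ := region h'
  simp only [a, Prod.fst_sub, Prod.snd_sub] at *
  ext
  · apply mul_left_cancel₀ h3.ne'
    dsimp only
    linarith
  · dsimp only
    linarith

theorem eq_of_mem_inter_b {n : ℕ} {v : ℝ × ℝ} (h : v ∈ V n) (h' : v - b n ∈ V n) : v = b n := by
  have h3 := sq3_pos
  obtain ⟨h1, h2, h4⟩ := region h
  obtain ⟨h1', h2', h4'⟩ := region h'
  simp only [b, Prod.fst_sub, Prod.snd_sub] at *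
  ext
  · apply mul_left_cancel₀ h3.ne'
    dsimp only
    linarith
  · dsimp only
    linarith

theorem eq_of_mem_inter_c {n : ℕ} {v : ℝ × ℝ} (h : v - a n ∈ V n) (h' : v - b n ∈ V n) :
    v = c n := by
  have h3 := sq3_pos
  obtain ⟨h1, h2, h4⟩ := region h
  obtain ⟨h1', h2', h4'⟩ := region h'
  simp only [a, b, c, Prod.fst_sub, Prod.snd_sub] at *
  ext
  · apply mul_left_cancel₀ h3.ne'
    dsimp only
    linarith
  · dsimp only
    linarith

theorem adj_iff {n : ℕ} {u v : ℝ × ℝ} : (G n).Adj u v ↔ s(u, v) ∈ E n ∧ u ≠ v :=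
  SimpleGraph.fromEdgeSet_adj _

theorem gas (n : ℕ) : Gas n (V n) (G n).Adj o (a n) (b n) := by
  have h3 := sq3_pos
  induction n with
  | zero =>
    have h1 : o ≠ a 0 := by simp [o, a]
    have h2 : o ≠ b 0 := by simp [o, b]
    have h3 : a 0 ≠ b 0 := by simp [a, b]
    refine .zero h1 h2 h3 (fun v => Iff.rfl) fun u v => ?_
    simp only [adj_iff, E, V, Set.mem_insert_iff, Set.mem_singleton_iff, Sym2.eq_iff]
    constructor
    · tauto
    · rintro ⟨rfl | rfl | rfl, rfl | rfl | rfl, h⟩ <;> simp_all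
  | succ n ih =>
    have g2 := ih.translate (a n)
    have g3 := ih.translate (b n)
    have e1 : o + a n = a n := by simp [o, a]
    have e2 : o + b n = b n := by simp [o, b]
    have e3 : a n + a n = a (n + 1) := by simp [a, pow_succ]; ring
    have e4 : b n + b n = b (n + 1) := by simp [b, pow_succ]; ring
    have e5 : b n + a n = c n := by simp [a, b, c]; ring
    have e6 : a n + b n = c n := by rw [add_comm, e5]
    rw [e1, e3, e5] at g2
    rw [e2, e4, e6] at g3
    refine .succ ih g2 g3 (fun v => eq_of_mem_inter_a) (fun v => eq_of_mem_inter_b)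
      (fun v => eq_of_mem_inter_c) (fun v => ?_) (fun u v => ?_)
    · simp only [V, Set.mem_union, mem_image_add, or_assoc, Set.mem_ofPred_eq]
    · simp only [adj_iff, E, Set.mem_union, mk_mem_image_add, or_assoc, ne_eq, sub_left_inj]
      tauto

theorem exists_walk {W : Type*} {K : SimpleGraph W} {x y : W} {m : List W}
    (h : (x :: (m ++ [y])).IsChain K.Adj) : ∃ w : K.Walk x y, w.support = x :: (m ++ [y]) :=
  ⟨(SimpleGraph.Walk.ofSupport _ (List.cons_ne_nil _ _) h).copy (List.head_cons ..) (by simp), by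
    rw [SimpleGraph.Walk.support_copy, SimpleGraph.Walk.support_ofSupport]⟩

theorem support_eq_of_not_nil {W : Type*} {K : SimpleGraph W} {x y : W} {w : K.Walk x y}
    (h : ¬ w.Nil) : w.support = x :: (w.support.tail.dropLast ++ [y]) := by
  cases w with
  | nil => simp at h
  | cons e w =>
    rw [SimpleGraph.Walk.support_cons, List.tail_cons, w.dropLast_support_concat]

theorem mem_hamCyc_iff {n : ℕ} {w : (G n).Walk o o} {m : List (ℝ × ℝ)}
    (hw : w.support = o :: (m ++ [o])) : IsHamCycle n w ↔ m ∈ HamCyc (V n) (G n).Adj o := by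
  have hg := gas n
  have hnil : ¬ w.Nil := by
    intro h
    rw [SimpleGraph.Walk.nil_iff_support_eq.1 h] at hw
    simp at hw
  have hmem : ∀ v, v ∈ w.support ↔ v ∈ o :: m := by
    intro v
    rw [hw]
    simp only [List.mem_cons, List.mem_append, List.not_mem_nil, or_false]
    tauto
  have hchain := w.isChain_adj_support
  rw [hw] at hchain
  have hl : w.length = m.length + 1 := by
    have := w.length_support
    rw [hw] at this
    simpa using this.symm
  have hpath : w.tail.IsPath ↔ (o :: m).Nodup := by
    rw [SimpleGraph.Walk.isPath_def, SimpleGraph.Walk.support_tail_of_not_nil _ hnil, hw,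
      List.tail_cons]
    exact (List.perm_append_comm (l₁ := m) (l₂ := [o])).nodup_iff
  rw [IsHamCycle, SimpleGraph.Walk.isCycle_iff_isPath_tail_and_le_length, hpath, hl]
  simp only [hmem]
  refine ⟨fun h => ⟨hchain, h.1.1, h.2⟩, fun h => ⟨⟨h.2.1, ?_⟩, h.2.2⟩⟩
  have h3 : [o, a n, b n].Nodup := by
    simp [hg.left_ne_mid, hg.left_ne_right, hg.mid_ne_right]
  have := (h3.subperm (l₂ := o :: m) (by
    intro v hv
    rw [h.2.2]
    simp only [List.mem_cons, List.not_mem_nil, or_false] at hv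
    rcases hv with rfl | rfl | rfl
    exacts [hg.left_mem, hg.mid_mem, hg.right_mem])).length_le
  simpa using this

theorem card_hamCycle (n : ℕ) :
    Nat.card {p : (G n).Walk o o // IsHamCycle n p} = (HamCyc (V n) (G n).Adj o).ncard := by
  rw [← Nat.card_coe_set_eq]
  have key : ∀ w : {p : (G n).Walk o o // IsHamCycle n p},
      w.1.support = o :: (w.1.support.tail.dropLast ++ [o]) :=
    fun w => support_eq_of_not_nil w.2.1.not_nil
  refine Nat.card_congr (Equiv.ofBijective
    (fun w => ⟨w.1.support.tail.dropLast, (mem_hamCyc_iff (key w)).1 w.2⟩) ⟨?_, ?_⟩)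
  · intro w w' h
    have h := Subtype.mk.inj h
    apply Subtype.ext
    apply SimpleGraph.Walk.ext_support
    rw [key w, key w', h]
  · rintro ⟨m, hm⟩
    obtain ⟨w, hw⟩ := exists_walk hm.1
    exact ⟨⟨w, (mem_hamCyc_iff hw).2 hm⟩, Subtype.ext (by simp [hw])⟩

theorem HC_succ (n : ℕ) : HC (n + 1) = (hamCount n).1 ^ 3 := by
  rw [HC, card_hamCycle, (gas (n + 1)).hamCyc_ncard]
  omega

theorem hamCount_snd (n : ℕ) : 2 * (hamCount (n + 1)).2 = 3 * (hamCount (n + 1)).1 := by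
  induction n with
  | zero => simp [hamCount]
  | succ n ih =>
    rw [hamCount]
    simp only [Nat.add_eq_zero_iff, one_ne_zero, and_false, if_false, add_zero]
    linear_combination 2 * (hamCount (n + 1)).1 * (hamCount (n + 1)).2 * ih

theorem hamCount_fst (n : ℕ) : (hamCount (n + 2)).1 = 3 * (hamCount (n + 1)).1 ^ 3 := by
  rw [hamCount]
  dsimp only
  linear_combination (hamCount (n + 1)).1 ^ 2 * hamCount_snd n

theorem log_hamCount (n : ℕ) : Real.log (hamCount (n + 1)).1 =
    3 ^ n * (Real.log 2 + Real.log 3 / 2) - Real.log 3 / 2 ∧ 0 < (hamCount (n + 1)).1 := by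
  induction n with
  | zero => simp [hamCount]
  | succ n ih =>
    rw [hamCount_fst]
    refine ⟨?_, by have := ih.2; positivity⟩
    have : ((hamCount (n + 1)).1 : ℝ) ≠ 0 := by exact_mod_cast ih.2.ne'
    push_cast
    rw [Real.log_mul (by norm_num) (by positivity), Real.log_pow, ih.1]
    push_cast
    ring

theorem log_HC (n : ℕ) : Real.log (HC (n + 2)) =
    Real.log 12 / 2 * 3 ^ (n + 1) - 3 * Real.log 3 / 2 := by
  have : Real.log 12 = 2 * Real.log 2 + Real.log 3 := by
    rw [show (12 : ℝ) = 2 ^ 2 * 3 by norm_num, Real.log_mul (by norm_num) (by norm_num),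
      Real.log_pow]
    norm_num
  rw [HC_succ, Nat.cast_pow, Real.log_pow, (log_hamCount n).1, this]
  push_cast
  ring

/-- the connectivity constant of Hamiltonian cycles on the
Sierpinski gasket is `12^(1/9)`. -/
theorem connectivity_constant :
    Filter.Tendsto (fun n : ℕ => Real.log (HC n) / ((3 / 2) * (3 ^ n + 1)))
      Filter.atTop (nhds (Real.log 12 / 9)) := by
  rw [← Filter.tendsto_add_atTop_iff_nat 2]
  have h0 : Tendsto (fun n : ℕ => ((1 / 3 : ℝ)) ^ n) atTop (𝓝 0) :=
    tendsto_pow_atTop_nhds_zero_of_lt_one (by norm_num) (by norm_num)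
  have h : Tendsto (fun n : ℕ => (Real.log 12 / 2 * 3 - 3 * Real.log 3 / 2 * (1 / 3 : ℝ) ^ n) /
      (3 / 2 * (9 + (1 / 3 : ℝ) ^ n))) atTop
      (𝓝 ((Real.log 12 / 2 * 3 - 3 * Real.log 3 / 2 * 0) / (3 / 2 * (9 + 0)))) :=
    (tendsto_const_nhds.sub (h0.const_mul _)).div ((tendsto_const_nhds.add h0).const_mul _)
      (by norm_num)
  convert h using 2 with n
  · rw [log_HC, one_div, inv_pow]
    field_simp
    ring
  · ring

end SierpinskiGasket
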